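/- For integers n ≥ 1 and d ≥ 1, let G_{n,d} be the unicyclic digraph obtained from the directed cycle C_n by attaching to each cycle vertex an out-tree with d leaves: for each cycle vertex v there is a new vertex c_v with an arc v → c_v, and d new leaf vertices each receiving an arc from c_v. Then the line digraph L(G_{n,d}) is isomorphic to G_{n,d}, and consequently, for every k ≥ 0, the k-iterated line digraph L^k(G_{n,d}) has exactly n(d+2) vertices. -/

import Mathlib

/-- A digraph: a vertex type together with an adjacency (arc) relation.
(Loops allowed, no multiple arcs.) -/
structure Digraph' where
  V : Type
  Adj : V → V → Prop

namespace Digraph'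

/-- `G.HasWalk k u v` means there is a directed walk of length `k` from `u` to `v`. -/
def HasWalk (G : Digraph') : ℕ → G.V → G.V → Prop
  | 0, u, v => u = v
  | (k + 1), u, v => ∃ w, G.Adj u w ∧ G.HasWalk k w v

/-- There is a directed walk from `u` to `v`. -/
def Reachable (G : Digraph') (u v : G.V) : Prop := ∃ k, G.HasWalk k u v

/-- The distance from `u` to `v`: the length of a shortest directed path
(junk value `0` when `v` is not reachable from `u`). -/
noncomputable def dist (G : Digraph') (u v : G.V) : ℕ := sInf {k | G.HasWalk k u v}

/-- A digraph is strongly connected when every vertex is reachable from every vertex. -/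
def StronglyConnected (G : Digraph') : Prop := ∀ u v : G.V, G.Reachable u v

/-- The (standard) diameter: maximum distance over all ordered pairs of vertices. -/
noncomputable def diam (G : Digraph') : ℕ := sSup {n | ∃ u v : G.V, G.dist u v = n}

/-- The inner diameter: maximum of the finite distances. -/
noncomputable def innerDiam (G : Digraph') : ℕ :=
  sSup {n | ∃ u v : G.V, G.Reachable u v ∧ G.dist u v = n}

/-- Inner out-eccentricity of a vertex. -/
noncomputable def eccOut (G : Digraph') (u : G.V) : ℕ :=
  sSup {n | ∃ v : G.V, G.Reachable u v ∧ G.dist u v = n}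

/-- Inner in-eccentricity of a vertex. -/
noncomputable def eccIn (G : Digraph') (u : G.V) : ℕ :=
  sSup {n | ∃ v : G.V, G.Reachable v u ∧ G.dist v u = n}

/-- Inner out-diameter `d⁺(G)`. -/
noncomputable def innerDiamOut (G : Digraph') : ℕ := sSup (Set.range G.eccOut)

/-- Inner in-diameter `d⁻(G)`. -/
noncomputable def innerDiamIn (G : Digraph') : ℕ := sSup (Set.range G.eccIn)

/-- Inner out-radius `r⁺(G)`. -/
noncomputable def radiusOut (G : Digraph') : ℕ := sInf (Set.range G.eccOut)

/-- Inner in-radius `r⁻(G)`. -/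
noncomputable def radiusIn (G : Digraph') : ℕ := sInf (Set.range G.eccIn)

/-- The line digraph: vertices are the arcs of `G`, and arc `(u,v)` is adjacent
to arc `(w,z)` iff `v = w`. -/
def line (G : Digraph') : Digraph' where
  V := {p : G.V × G.V // G.Adj p.1 p.2}
  Adj a b := a.val.2 = b.val.1

/-- The `k`-iterated line digraph. -/
def iterLine (G : Digraph') : ℕ → Digraph'
  | 0 => G
  | (k + 1) => (G.iterLine k).line

/-- Two digraphs are isomorphic. -/
def IsIsomorphic (G H : Digraph') : Prop :=
  ∃ e : G.V ≃ H.V, ∀ u v : G.V, G.Adj u v ↔ H.Adj (e u) (e v)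

/-- The directed cycle on `n` vertices. -/
def cycleDigraph (n : ℕ) : Digraph' where
  V := ZMod n
  Adj i j := j = i + 1

/-- A digraph is a directed cycle if it is isomorphic to `C_n` for some `n ≥ 1`. -/
def IsDirectedCycle (G : Digraph') : Prop :=
  ∃ n : ℕ, 1 ≤ n ∧ G.IsIsomorphic (cycleDigraph n)

end Digraph'

/-- The unicyclic digraph `G_{n,d}`: a directed cycle `C_n` (vertices `Sum.inl i`),
where each cycle vertex `i` has an arc to a centre vertex `c_i`
(`Sum.inr (Sum.inl i)`), and each centre vertex `c_i` has arcs to `d` leaves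
(`Sum.inr (Sum.inr (i, j))` for `j : Fin d`). -/
def unicyclic (n d : ℕ) : Digraph' where
  V := ZMod n ⊕ (ZMod n ⊕ ZMod n × Fin d)
  Adj u v :=
    match u, v with
    | Sum.inl i, Sum.inl j => j = i + 1
    | Sum.inl i, Sum.inr (Sum.inl j) => j = i
    | Sum.inr (Sum.inl i), Sum.inr (Sum.inr (j, _)) => j = i
    | _, _ => False

/-- If every vertex has exactly one in-neighbour, taking heads is an isomorphism. -/
theorem line_iso_of_unique (G : Digraph') (h : ∀ v, ∃! u, G.Adj u v) :
    G.line.IsIsomorphic G := by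
  refine ⟨Equiv.ofBijective (fun a : G.line.V => a.val.2) ⟨?_, ?_⟩, ?_⟩
  · rintro ⟨⟨a, b⟩, hab⟩ ⟨⟨c, e⟩, hce⟩ hh
    have hh' : b = e := hh
    subst hh'
    have hac : a = c := (h b).unique hab hce
    subst hac
    rfl
  · intro v
    obtain ⟨u, hu, -⟩ := h v
    exact ⟨⟨(u, v), hu⟩, rfl⟩
  · rintro ⟨⟨a, b⟩, hab⟩ ⟨⟨c, e⟩, hce⟩
    change b = c ↔ G.Adj b e
    constructor
    · rintro rfl
      exact hce
    · intro hbe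
      exact (h e).unique hbe hce

theorem line_unique (G : Digraph') (h : ∀ v, ∃! u, G.Adj u v) :
    ∀ v, ∃! u, G.line.Adj u v := by
  rintro ⟨⟨c, e⟩, hce⟩
  obtain ⟨u, hu, huu⟩ := h c
  refine ⟨⟨(u, c), hu⟩, rfl, ?_⟩
  rintro ⟨⟨a, b⟩, hab⟩ hh
  have hh' : b = c := hh
  subst hh'
  have hau : a = u := huu a hab
  subst hau
  rfl

theorem unicyclic_unique (n d : ℕ) : ∀ v, ∃! u, (unicyclic n d).Adj u v := by
  rintro (j | j | ⟨j, l⟩)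
  · refine ⟨Sum.inl (j - 1), ?_, ?_⟩
    · change j = j - 1 + 1
      ring
    · rintro (i | i | ⟨i, m⟩) hi
      · have hi' : j = i + 1 := hi
        subst hi'
        rw [add_sub_cancel_right]
      · exact hi.elim
      · exact hi.elim
  · refine ⟨Sum.inl j, rfl, ?_⟩
    rintro (i | i | ⟨i, m⟩) hi
    · have hi' : j = i := hi
      rw [hi']
    · exact hi.elim
    · exact hi.elim
  · refine ⟨Sum.inr (Sum.inl j), rfl, ?_⟩
    rintro (i | i | ⟨i, m⟩) hi
    · exact hi.elim
    · have hi' : j = i := hi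
      rw [hi']
    · exact hi.elim

theorem iterLine_unique (n d : ℕ) (k : ℕ) :
    ∀ v, ∃! u, ((unicyclic n d).iterLine k).Adj u v := by
  induction k with
  | zero => exact unicyclic_unique n d
  | succ k ih => exact line_unique _ ih

/-- For `n ≥ 1` and `d ≥ 1`, the line digraph of `G_{n,d}` is
isomorphic to `G_{n,d}` and, consequently, every iterated line digraph
`L^k(G_{n,d})` has exactly `n(d+2)` vertices. -/
theorem stmt_19 (n d : ℕ) (hn : 1 ≤ n) (hd : 1 ≤ d) :
    ((unicyclic n d).line).IsIsomorphic (unicyclic n d) ∧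
    ∀ k : ℕ, Nat.card ((unicyclic n d).iterLine k).V = n * (d + 2) := by
  refine ⟨line_iso_of_unique _ (unicyclic_unique n d), fun k => ?_⟩
  induction k with
  | zero =>
    change Nat.card (ZMod n ⊕ (ZMod n ⊕ ZMod n × Fin d)) = _
    haveI : NeZero n := ⟨by omega⟩
    simp only [Nat.card_sum, Nat.card_prod, Nat.card_zmod, Nat.card_fin]
    ring
  | succ k ih =>
    obtain ⟨e, -⟩ := line_iso_of_unique _ (iterLine_unique n d k)
    rw [← ih]
    exact Nat.card_congr e
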